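/- Let X and Y be real vector spaces, let 𝔽_X be a family of F-seminorms on X and 𝔽_Y a family of F-seminorms on Y, let T₁, T₂ : X → Y be maps, x̄ ∈ X, and let a₁, a₂ be real scalars. If the linear map L₁ satisfies the Fréchet differentiability conditions for T₁ at x̄ with respect to 𝔽_X and 𝔽_Y, and the linear map L₂ satisfies them for T₂ at x̄, then the linear map a₁ • L₁ + a₂ • L₂ satisfies the Fréchet differentiability conditions for the map x ↦ a₁ • T₁(x) + a₂ • T₂(x) at x̄ with respect to 𝔽_X and 𝔽_Y. -/

import Mathlib

/-- An F-seminorm on a real vector space. -/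
def IsFSeminorm {V : Type*} [AddCommGroup V] [Module ℝ V] (p : V → ℝ) : Prop :=
  (∀ x, 0 ≤ p x) ∧ (∀ x y, p (x + y) ≤ p x + p y) ∧
  (∀ (a : ℝ) (x : V), |a| ≤ 1 → p (a • x) ≤ p x) ∧
  (∀ x : V, Filter.Tendsto (fun n : ℕ => p ((1 / (n : ℝ)) • x)) Filter.atTop (nhds 0))

/-- The map `L` satisfies the Fréchet differentiability conditions (DZ) and (DR) for `T`
at `x0` with respect to the families of F-seminorms `p` on the domain and `q` on the range. -/
def SatisfiesFrechetConditions {X Y : Type*} {ι κ : Type*} [AddCommGroup X] [Module ℝ X]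
    [AddCommGroup Y] [Module ℝ Y]
    (p : ι → X → ℝ) (q : κ → Y → ℝ) (T : X → Y) (x0 : X) (L : X → Y) : Prop :=
  ∀ (J : Finset κ) (hJ : J.Nonempty) (ε : ℝ), 0 < ε →
    ∃ (I : Finset ι) (hI : I.Nonempty) (δ : ℝ), 0 < δ ∧ ∀ u : X,
      (I.sup' hI (fun i => p i u) = 0 →
        J.sup' hJ (fun j => q j (T (x0 + u) - T x0 - L u)) = 0) ∧
      (0 < I.sup' hI (fun i => p i u) → I.sup' hI (fun i => p i u) < δ →
        J.sup' hJ (fun j =>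
          q j ((I.sup' hI (fun i => p i u))⁻¹ • (T (x0 + u) - T x0 - L u))) < ε)

theorem IsFSeminorm.nsmul_le {V : Type*} [AddCommGroup V] [Module ℝ V] {p : V → ℝ}
    (hp : IsFSeminorm p) (n : ℕ) (x : V) : p ((n : ℝ) • x) ≤ n * p x := by
  induction n with
  | zero => simpa using ge_of_tendsto (hp.2.2.2 0) (by simp)
  | succ n ih =>
    push_cast
    rw [add_smul, one_smul, add_one_mul]
    exact (hp.2.1 _ _).trans (by gcongr)

theorem IsFSeminorm.smul_le_natCast_mul {V : Type*} [AddCommGroup V] [Module ℝ V] {p : V → ℝ}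
    (hp : IsFSeminorm p) {a : ℝ} {n : ℕ} (ha : |a| ≤ n) (x : V) : p (a • x) ≤ n * p x := by
  rcases n.eq_zero_or_pos with rfl | hn
  · obtain rfl : a = 0 := by simpa using ha
    simpa using hp.nsmul_le 0 x
  · have hn' : (0 : ℝ) < n := by exact_mod_cast hn
    have h := hp.2.2.1 (a / n) ((n : ℝ) • x) (by
      rwa [abs_div, Nat.abs_cast, div_le_one hn'])
    rw [smul_smul, div_mul_cancel₀ _ hn'.ne'] at h
    exact h.trans (hp.nsmul_le n x)

theorem IsFSeminorm.smul_eq_zero {V : Type*} [AddCommGroup V] [Module ℝ V] {p : V → ℝ}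
    (hp : IsFSeminorm p) {x : V} (hx : p x = 0) (a : ℝ) : p (a • x) = 0 := by
  obtain ⟨n, hn⟩ := exists_nat_ge |a|
  exact le_antisymm (by simpa [hx] using hp.smul_le_natCast_mul hn x) (hp.1 _)

/-- In the Fréchet differentiability conditions, the maximum of the F-seminorms on the domain may
be replaced by any larger number. -/
theorem SatisfiesFrechetConditions.exists_forall_ge_sup' {X Y : Type*} {ι κ : Type*}
    [AddCommGroup X] [Module ℝ X] [AddCommGroup Y] [Module ℝ Y]
    {p : ι → X → ℝ} (hp : ∀ i, IsFSeminorm (p i)) {q : κ → Y → ℝ} (hq : ∀ j, IsFSeminorm (q j))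
    {T : X → Y} {x0 : X} {L : X → Y} (h : SatisfiesFrechetConditions p q T x0 L)
    {J : Finset κ} (hJ : J.Nonempty) {ε : ℝ} (hε : 0 < ε) :
    ∃ (I : Finset ι) (hI : I.Nonempty) (δ : ℝ), 0 < δ ∧ ∀ (u : X) (s : ℝ),
      I.sup' hI (fun i => p i u) ≤ s →
      (s = 0 → ∀ j ∈ J, q j (T (x0 + u) - T x0 - L u) = 0) ∧
      (0 < s → s < δ → ∀ j ∈ J, q j (s⁻¹ • (T (x0 + u) - T x0 - L u)) < ε) := by
  obtain ⟨I, hI, δ, hδ, H⟩ := h J hJ ε hε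
  refine ⟨I, hI, δ, hδ, fun u s hs => ?_⟩
  obtain ⟨hz, hr⟩ := H u
  have ht : 0 ≤ I.sup' hI (fun i => p i u) := by
    obtain ⟨i, hi⟩ := hI
    exact ((hp i).1 u).trans (Finset.le_sup' (fun i => p i u) hi)
  set t := I.sup' hI (fun i => p i u)
  set R := T (x0 + u) - T x0 - L u
  have hz' (h0 : t = 0) (j : κ) (hj : j ∈ J) : q j R = 0 :=
    le_antisymm ((Finset.le_sup' (fun j => q j R) hj).trans (hz h0).le) ((hq j).1 _)
  refine ⟨fun h0 => hz' (le_antisymm (h0 ▸ hs) ht), fun hs0 hsδ j hj => ?_⟩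
  rcases ht.eq_or_lt with h0 | h0
  · rwa [(hq j).smul_eq_zero (hz' h0.symm j hj)]
  · have hst : s⁻¹ • R = (t / s) • t⁻¹ • R := by
      rw [smul_smul]
      congr 1
      field_simp
    rw [hst]
    refine ((hq j).2.2.1 _ _ ?_).trans_lt
      ((Finset.sup'_lt_iff hJ).1 (hr h0 (hs.trans_lt hsδ)) j hj)
    rwa [abs_of_nonneg (by positivity), div_le_one hs0]

theorem stmt6 {X Y : Type*} {ι κ : Type*} [AddCommGroup X] [Module ℝ X]
    [AddCommGroup Y] [Module ℝ Y]
    (p : ι → X → ℝ) (hp : ∀ i, IsFSeminorm (p i))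
    (q : κ → Y → ℝ) (hq : ∀ j, IsFSeminorm (q j))
    (T₁ T₂ : X → Y) (x0 : X) (a₁ a₂ : ℝ) (L₁ L₂ : X →ₗ[ℝ] Y)
    (h1 : SatisfiesFrechetConditions p q T₁ x0 (fun u => L₁ u))
    (h2 : SatisfiesFrechetConditions p q T₂ x0 (fun u => L₂ u)) :
    SatisfiesFrechetConditions p q (fun x => a₁ • T₁ x + a₂ • T₂ x) x0
      (fun u => (a₁ • L₁ + a₂ • L₂) u) := by
  intro J hJ ε hε
  obtain ⟨N, hN⟩ := exists_nat_ge (max 1 (max |a₁| |a₂|))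
  have hN0 : (1 : ℝ) ≤ N := (le_max_left _ _).trans hN
  have hN1 : |a₁| ≤ N := (le_max_left _ _).trans ((le_max_right _ _).trans hN)
  have hN2 : |a₂| ≤ N := (le_max_right _ _).trans ((le_max_right _ _).trans hN)
  have hε' : 0 < ε / (2 * N) := by positivity
  obtain ⟨I₁, hI₁, δ₁, hδ₁, H₁⟩ := h1.exists_forall_ge_sup' hp hq hJ hε'
  obtain ⟨I₂, hI₂, δ₂, hδ₂, H₂⟩ := h2.exists_forall_ge_sup' hp hq hJ hε'
  classical
  have hI : (I₁ ∪ I₂).Nonempty := hI₁.mono Finset.subset_union_left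
  refine ⟨I₁ ∪ I₂, hI, min δ₁ δ₂, lt_min hδ₁ hδ₂, fun u => ?_⟩
  have hs₁ := Finset.sup'_mono (fun i => p i u) (Finset.subset_union_left (s₂ := I₂)) hI₁
  have hs₂ := Finset.sup'_mono (fun i => p i u) (Finset.subset_union_right (s₁ := I₁)) hI₂
  set s := (I₁ ∪ I₂).sup' hI (fun i => p i u)
  obtain ⟨hz₁, hr₁⟩ := H₁ u s hs₁
  obtain ⟨hz₂, hr₂⟩ := H₂ u s hs₂
  set R₁ := T₁ (x0 + u) - T₁ x0 - L₁ u
  set R₂ := T₂ (x0 + u) - T₂ x0 - L₂ u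
  have hR : a₁ • T₁ (x0 + u) + a₂ • T₂ (x0 + u) - (a₁ • T₁ x0 + a₂ • T₂ x0)
      - (a₁ • L₁ + a₂ • L₂) u = a₁ • R₁ + a₂ • R₂ := by
    simp only [R₁, R₂, LinearMap.add_apply, LinearMap.smul_apply]
    module
  simp only [hR]
  have bound (j : κ) (x y : Y) : q j (a₁ • x + a₂ • y) ≤ N * q j x + N * q j y :=
    ((hq j).2.1 _ _).trans
      (add_le_add ((hq j).smul_le_natCast_mul hN1 x) ((hq j).smul_le_natCast_mul hN2 y))
  refine ⟨fun hs => ?_, fun hs hsδ => ?_⟩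
  · refine (Finset.sup'_congr hJ rfl fun j hj => ?_).trans (Finset.sup'_const hJ 0)
    have := bound j R₁ R₂
    rw [hz₁ hs j hj, hz₂ hs j hj] at this
    exact le_antisymm (by simpa using this) ((hq j).1 _)
  · refine (Finset.sup'_lt_iff hJ).2 fun j hj => ?_
    have h₁ := hr₁ hs (hsδ.trans_le (min_le_left _ _)) j hj
    have h₂ := hr₂ hs (hsδ.trans_le (min_le_right _ _)) j hj
    rw [smul_add, smul_comm _ a₁, smul_comm _ a₂]
    calc _ ≤ N * q j (s⁻¹ • R₁) + N * q j (s⁻¹ • R₂) := bound j _ _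
      _ < N * (ε / (2 * N)) + N * (ε / (2 * N)) := by gcongr
      _ = ε := by field_simp; ring
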